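/- Let γ, γ̃ ∈ ℂ with 0 < Re γ < 1/2, 0 < Re γ̃ < 1/2 and 0 < Re(γ + γ̃) < 1/2. Define Î(γ, γ̃) = lim_{R→∞} ∫₀^{R} ∫₀^{2π} r^{γ+γ̃−1} e^{i(γ−γ̃)θ} e^{2ir·cos θ} dθ dr, and J(γ, γ̃) = ∫₀^{∞} v^{γ̃−1} e^{iv} · ( lim_{T→∞} ∫_{v}^{T} u^{γ−1} e^{iu} du ) dv. Then all indicated limits and integrals exist, and Î(γ, γ̃) = (i/2)·(1 − e^{2πiγ})·e^{−2πiγ̃}·e^{iπ(γ+γ̃)/2}·Γ(γ)·Γ(γ̃) + (i/2)·(e^{2πi(γ−γ̃)} − 1)·J(γ, γ̃). -/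

import Mathlib

open Real MeasureTheory Filter Topology

lemma integral_cexp_mul_comp_exp (s : ℂ) {h : ℝ → ℂ} {a b : ℝ} (hab : a ≤ b)
    (hh : ContinuousOn h (Set.Icc (rexp a) (rexp b))) :
    ∫ x in a..b, Complex.exp (s * x) * h (rexp x) =
      ∫ u in rexp a..rexp b, (u : ℂ) ^ (s - 1) * h u := by
  have key := intervalIntegral.integral_deriv_smul_comp' (a := a) (b := b) (f := rexp) (f' := rexp)
    (g := fun u : ℝ => (u : ℂ) ^ (s - 1) * h u) (fun x _ => Real.hasDerivAt_exp x)
    Real.continuous_exp.continuousOn ?_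
  · rw [← key]
    refine intervalIntegral.integral_congr fun x _ => ?_
    simp only [Function.comp, Complex.real_smul]
    rw [Complex.cpow_def_of_ne_zero (by simp [Complex.exp_ne_zero]), ← Complex.ofReal_log (exp_pos x).le,
      Real.log_exp, ← mul_assoc, Complex.ofReal_exp, ← Complex.exp_add]
    ring_nf
  · refine ContinuousOn.mul (fun u hu => ContinuousAt.continuousWithinAt ?_) (hh.mono ?_)
    · obtain ⟨x, -, rfl⟩ := hu
      exact Complex.continuousAt_ofReal_cpow_const _ _ (Or.inr (exp_pos x).ne')
    · rintro _ ⟨x, hx, rfl⟩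
      rw [Set.uIcc_of_le hab] at hx
      exact ⟨exp_le_exp.2 hx.1, exp_le_exp.2 hx.2⟩

/-- Cauchy's theorem on the annular sector `exp a ≤ |z| ≤ exp b`, `arg z` between `0` and `φ`. -/
lemma integral_sector_eq_zero (s : ℂ) (H : ℂ → ℂ) {a b : ℝ} (hab : a ≤ b) (φ : ℝ)
    (hH : DifferentiableOn ℂ (fun w => H (Complex.exp w)) (Set.Icc a b ×ℂ Set.uIcc 0 φ)) :
    (∫ u in rexp a..rexp b, (u : ℂ) ^ (s - 1) * H u) -
      Complex.exp (s * (φ * Complex.I)) *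
        (∫ u in rexp a..rexp b, (u : ℂ) ^ (s - 1) * H (u * Complex.exp (φ * Complex.I))) +
      Complex.I * (∫ θ in (0:ℝ)..φ, Complex.exp (s * (b + θ * Complex.I)) *
        H (Complex.exp (b + θ * Complex.I))) -
      Complex.I * (∫ θ in (0:ℝ)..φ, Complex.exp (s * (a + θ * Complex.I)) *
        H (Complex.exp (a + θ * Complex.I))) = 0 := by
  have hline : ∀ ψ ∈ Set.uIcc 0 φ, ContinuousOn (fun u : ℝ => H (u * Complex.exp (ψ * Complex.I)))
      (Set.Icc (rexp a) (rexp b)) := by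
    intro ψ hψ
    have : ContinuousOn (fun u : ℝ => H (Complex.exp ((Real.log u : ℝ) + ψ * Complex.I)))
        (Set.Icc (rexp a) (rexp b)) := by
      refine hH.continuousOn.comp (f := fun u : ℝ => ((Real.log u : ℝ) + ψ * Complex.I : ℂ)) ?_ ?_
      · refine ContinuousOn.add (Complex.continuous_ofReal.comp_continuousOn ?_) continuousOn_const
        exact Real.continuousOn_log.mono fun u hu => ((exp_pos a).trans_le hu.1).ne'
      · intro u hu
        have hu0 := (exp_pos a).trans_le hu.1
        rw [Complex.mem_reProdIm]
        simpa using And.intro ⟨(le_log_iff_exp_le hu0).2 hu.1, (log_le_iff_le_exp hu0).2 hu.2⟩ hψ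
    refine this.congr fun u hu => ?_
    have hu0 := (exp_pos a).trans_le hu.1
    simp only
    rw [Complex.exp_add, ← Complex.ofReal_exp, Real.exp_log hu0]
  have h := Complex.integral_boundary_rect_eq_zero_of_differentiableOn
    (fun w => Complex.exp (s * w) * H (Complex.exp w)) a (b + φ * Complex.I) (by
      refine DifferentiableOn.mul (by fun_prop) ?_
      simpa [Set.uIcc_of_le hab] using hH)
  simp only [Complex.add_re, Complex.ofReal_re, Complex.mul_re, Complex.I_re, mul_zero,
    Complex.ofReal_im, Complex.I_im, Complex.add_im, Complex.mul_im, add_zero, zero_mul,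
    mul_one, zero_add, Complex.ofReal_zero, smul_eq_mul, sub_self] at h
  rw [← h]
  congr 3
  · rw [← integral_cexp_mul_comp_exp s (h := fun u => H u) hab (by simpa using hline 0 Set.left_mem_uIcc)]
    simp
  · rw [← integral_cexp_mul_comp_exp s (h := fun u => H (u * Complex.exp (φ * Complex.I))) hab
      (hline φ Set.right_mem_uIcc), ← intervalIntegral.integral_const_mul]
    refine intervalIntegral.integral_congr fun x _ => ?_
    simp only [Complex.exp_add, mul_add, Complex.ofReal_exp]
    ring

lemma intervalIntegrable_cpow_mul_of_bdd {s : ℂ} (hs : 0 < s.re) {h : ℝ → ℂ} {R C : ℝ}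
    (hR : 0 ≤ R) (hc : ContinuousOn h (Set.Ioc 0 R)) (hC : ∀ u ∈ Set.Ioc 0 R, ‖h u‖ ≤ C) :
    IntervalIntegrable (fun u : ℝ => (u : ℂ) ^ (s - 1) * h u) volume 0 R := by
  have h1 : IntervalIntegrable (fun u : ℝ => (u : ℂ) ^ (s - 1)) volume 0 R :=
    intervalIntegral.intervalIntegrable_cpow' (by simpa using hs)
  rw [intervalIntegrable_iff_integrableOn_Ioc_of_le hR] at h1 ⊢
  exact Integrable.mul_bdd h1 (hc.aestronglyMeasurable measurableSet_Ioc)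
    ((ae_restrict_iff' measurableSet_Ioc).2 (ae_of_all _ hC))

lemma tendsto_integral_left_zero {f : ℝ → ℂ} {R : ℝ} (hR : 0 < R)
    (hf : IntervalIntegrable f volume 0 R) :
    Tendsto (fun a : ℝ => ∫ u in rexp a..R, f u) atBot (𝓝 (∫ u in (0:ℝ)..R, f u)) := by
  have h1 := intervalIntegral.continuousOn_primitive_interval_left
    (f := f) (μ := volume) (a := 0) (b := R) (by
      rw [Set.uIcc_of_le hR.le]
      rwa [intervalIntegrable_iff_integrableOn_Icc_of_le hR.le] at hf)
  have h2 := h1 0 Set.left_mem_uIcc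
  refine h2.tendsto.comp (tendsto_nhdsWithin_iff.2 ⟨Real.tendsto_exp_atBot, ?_⟩)
  filter_upwards [eventually_le_atBot (Real.log R)] with a ha
  rw [Set.uIcc_of_le hR.le]
  exact ⟨(exp_pos a).le, (le_log_iff_exp_le hR).1 ha⟩

/-- Cauchy's theorem on the circular sector `0 < |z| ≤ exp b`, `arg z` between `0` and `φ`. -/
lemma integral_sector_zero_eq_zero {s : ℂ} (hs : 0 < s.re) (H : ℂ → ℂ) (b φ C : ℝ)
    (hH : DifferentiableOn ℂ (fun w => H (Complex.exp w)) (Set.Iic b ×ℂ Set.uIcc 0 φ))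
    (hC : ∀ w ∈ Set.Iic b ×ℂ Set.uIcc 0 φ, ‖H (Complex.exp w)‖ ≤ C) :
    (∫ u in (0:ℝ)..rexp b, (u : ℂ) ^ (s - 1) * H u) -
      Complex.exp (s * (φ * Complex.I)) *
        (∫ u in (0:ℝ)..rexp b, (u : ℂ) ^ (s - 1) * H (u * Complex.exp (φ * Complex.I))) +
      Complex.I * (∫ θ in (0:ℝ)..φ, Complex.exp (s * (b + θ * Complex.I)) *
        H (Complex.exp (b + θ * Complex.I))) = 0 := by
  have hmem : ∀ ψ ∈ Set.uIcc 0 φ, ∀ u ∈ Set.Ioc 0 (rexp b),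
      ((Real.log u : ℝ) + ψ * Complex.I : ℂ) ∈ Set.Iic b ×ℂ Set.uIcc 0 φ := by
    intro ψ hψ u hu
    rw [Complex.mem_reProdIm]
    simpa using And.intro ((log_le_iff_le_exp hu.1).2 hu.2) hψ
  have hexp : ∀ (ψ : ℝ), ∀ u ∈ Set.Ioc 0 (rexp b),
      Complex.exp ((Real.log u : ℝ) + ψ * Complex.I) = u * Complex.exp (ψ * Complex.I) := by
    intro ψ u hu
    rw [Complex.exp_add, ← Complex.ofReal_exp, Real.exp_log hu.1]
  have hint : ∀ ψ ∈ Set.uIcc 0 φ, IntervalIntegrable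
      (fun u : ℝ => (u : ℂ) ^ (s - 1) * H (u * Complex.exp (ψ * Complex.I))) volume 0 (rexp b) := by
    intro ψ hψ
    refine intervalIntegrable_cpow_mul_of_bdd hs (exp_pos b).le ?_ (C := C) ?_
    · have : ContinuousOn (fun u : ℝ => H (Complex.exp ((Real.log u : ℝ) + ψ * Complex.I)))
          (Set.Ioc 0 (rexp b)) := by
        refine hH.continuousOn.comp (f := fun u : ℝ => ((Real.log u : ℝ) + ψ * Complex.I : ℂ)) ?_
          (hmem ψ hψ)
        refine ContinuousOn.add (Complex.continuous_ofReal.comp_continuousOn ?_) continuousOn_const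
        exact Real.continuousOn_log.mono fun u hu => hu.1.ne'
      exact this.congr fun u hu => by simp only [hexp ψ u hu]
    · intro u hu
      rw [← hexp ψ u hu]
      exact hC _ (hmem ψ hψ u hu)
  have hedge : Tendsto (fun a : ℝ => ∫ θ in (0:ℝ)..φ, Complex.exp (s * (a + θ * Complex.I)) *
      H (Complex.exp (a + θ * Complex.I))) atBot (𝓝 0) := by
    have hlim : Tendsto (fun a : ℝ => rexp (s.re * a) * (rexp (|s.im| * |φ|) * C * |φ - 0|))
        atBot (𝓝 0) := by
      have : Tendsto (fun a : ℝ => rexp (s.re * a)) atBot (𝓝 0) :=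
        Real.tendsto_exp_atBot.comp (tendsto_id.const_mul_atBot hs)
      simpa using this.mul_const (rexp (|s.im| * |φ|) * C * |φ - 0|)
    refine squeeze_zero_norm' ?_ hlim
    filter_upwards [eventually_le_atBot b] with a ha
    refine (intervalIntegral.norm_integral_le_of_norm_le_const
      (C := rexp (s.re * a) * (rexp (|s.im| * |φ|) * C)) fun θ hθ => ?_).trans_eq (by ring)
    have hθ' := Set.uIoc_subset_uIcc hθ
    have hθφ : |θ| ≤ |φ| := by simpa using Set.abs_sub_left_of_mem_uIcc hθ'
    rw [norm_mul, Complex.norm_exp, ← mul_assoc, ← Real.exp_add]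
    refine mul_le_mul (exp_le_exp.2 ?_) (hC _ ?_) (norm_nonneg _) (exp_pos _).le
    · have : -(s.im * θ) ≤ |s.im| * |φ| :=
        (neg_le_abs _).trans (by rw [abs_mul]; gcongr)
      simpa [sub_eq_add_neg] using this
    · rw [Complex.mem_reProdIm]
      simpa using And.intro ha hθ'
  have key : ∀ a ≤ b, _ := fun a hab => integral_sector_eq_zero s H (a := a) (b := b) hab φ
    (hH.mono fun w hw => ⟨hw.1.2, hw.2⟩)
  refine tendsto_nhds_unique (f := fun _ : ℝ => (0:ℂ)) (l := atBot) ?_ tendsto_const_nhds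
  have := (((tendsto_integral_left_zero (exp_pos b)
    (by simpa using hint 0 Set.left_mem_uIcc)).sub
    ((tendsto_integral_left_zero (exp_pos b) (hint φ Set.right_mem_uIcc)).const_mul
      (Complex.exp (s * (φ * Complex.I))))).add_const
    (Complex.I * (∫ θ in (0:ℝ)..φ, Complex.exp (s * (b + θ * Complex.I)) *
        H (Complex.exp (b + θ * Complex.I))))).sub (hedge.const_mul Complex.I)
  rw [mul_zero, sub_zero] at this
  refine this.congr' ?_
  filter_upwards [eventually_le_atBot b] with a ha using key a ha

lemma integral_exp_neg_mul_cos_le {k : ℝ} (hk : 0 < k) :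
    ∫ θ in (0:ℝ)..(π / 2), rexp (-(k * Real.cos θ)) ≤ π / 2 * k⁻¹ := by
  have hF : ∀ θ : ℝ, HasDerivAt (fun θ : ℝ => π / 2 * k⁻¹ * rexp (-(k * (1 - 2 / π * θ))))
      (rexp (-(k * (1 - 2 / π * θ)))) θ := by
    intro θ
    have h1 : HasDerivAt (fun θ : ℝ => -(k * (1 - 2 / π * θ))) (k * (2 / π)) θ := by
      have := ((((hasDerivAt_id θ).const_mul (2 / π)).const_sub 1).const_mul k).neg
      convert this using 1 <;> first | rfl | ring
    exact ((h1.exp).const_mul (π / 2 * k⁻¹)).congr_deriv (by field_simp)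
  calc ∫ θ in (0:ℝ)..(π / 2), rexp (-(k * Real.cos θ))
      ≤ ∫ θ in (0:ℝ)..(π / 2), rexp (-(k * (1 - 2 / π * θ))) := by
        refine intervalIntegral.integral_mono_on (by positivity)
          (Continuous.intervalIntegrable (by fun_prop) _ _)
          (Continuous.intervalIntegrable (by fun_prop) _ _) fun θ hθ => ?_
        have := Real.one_sub_mul_le_cos hθ.1 hθ.2
        gcongr
    _ = _ := intervalIntegral.integral_eq_sub_of_hasDerivAt (fun θ _ => hF θ)
          (Continuous.intervalIntegrable (by fun_prop) _ _)
    _ ≤ π / 2 * k⁻¹ := by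
        have h1 : -(k * (1 - 2 / π * (π / 2))) = 0 := by field_simp; ring
        rw [h1, Real.exp_zero, mul_one]
        have : 0 < π / 2 * k⁻¹ * rexp (-(k * (1 - 2 / π * 0))) := by positivity
        linarith

lemma tendsto_integral_cpow_mul_exp_neg_I {s : ℂ} (hs : 0 < s.re) (hs1 : s.re < 1) :
    Tendsto (fun X : ℝ => ∫ u in (0:ℝ)..X, (u : ℂ) ^ (s - 1) * Complex.exp (-(Complex.I * u)))
      atTop (𝓝 (Complex.exp (-(Complex.I * π * s / 2)) * Complex.Gamma s)) := by
  have hrot : Complex.exp ((π / 2 : ℝ) * Complex.I) = Complex.I := by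
    push_cast; exact Complex.exp_pi_div_two_mul_I
  have hsec := fun b : ℝ => integral_sector_zero_eq_zero hs (fun z => Complex.exp (-z)) b (π / 2) 1
    (by fun_prop) (by
      intro w hw
      rw [Complex.mem_reProdIm, Set.uIcc_of_le (by positivity)] at hw
      rw [Complex.norm_exp, Real.exp_le_one_iff, Complex.neg_re, Complex.exp_re, neg_nonpos]
      exact mul_nonneg (exp_pos _).le
        (Real.cos_nonneg_of_neg_pi_div_two_le_of_le (by linarith [hw.2.1, pi_pos]) hw.2.2))
  have hedge : Tendsto (fun b : ℝ => ∫ θ in (0:ℝ)..(π / 2), Complex.exp (s * (b + θ * Complex.I)) *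
      Complex.exp (-Complex.exp (b + θ * Complex.I))) atTop (𝓝 0) := by
    have hlim : Tendsto (fun b : ℝ => rexp (|s.im| * (π / 2)) * (π / 2) * rexp ((s.re - 1) * b))
        atTop (𝓝 0) := by
      have : Tendsto (fun b : ℝ => rexp ((s.re - 1) * b)) atTop (𝓝 0) :=
        Real.tendsto_exp_atBot.comp (tendsto_id.const_mul_atTop_of_neg (by linarith))
      simpa using this.const_mul (rexp (|s.im| * (π / 2)) * (π / 2))
    refine squeeze_zero_norm (fun b => ?_) hlim
    calc ‖∫ θ in (0:ℝ)..(π / 2), Complex.exp (s * (b + θ * Complex.I)) *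
            Complex.exp (-Complex.exp (b + θ * Complex.I))‖
        ≤ ∫ θ in (0:ℝ)..(π / 2), rexp (s.re * b + |s.im| * (π / 2)) *
            rexp (-(rexp b * Real.cos θ)) := by
          refine intervalIntegral.norm_integral_le_of_norm_le (by positivity)
            (ae_of_all _ fun θ hθ => ?_) (Continuous.intervalIntegrable (by fun_prop) _ _)
          rw [norm_mul, Complex.norm_exp, Complex.norm_exp]
          refine mul_le_mul (exp_le_exp.2 ?_) (le_of_eq ?_) (exp_pos _).le (exp_pos _).le
          · have : -(s.im * θ) ≤ |s.im| * (π / 2) :=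
              (neg_le_abs _).trans (by
                rw [abs_mul]; gcongr; rw [abs_of_pos hθ.1]; exact hθ.2)
            simpa [sub_eq_add_neg] using this
          · simp [Complex.exp_re]
      _ ≤ rexp (s.re * b + |s.im| * (π / 2)) * (π / 2 * (rexp b)⁻¹) := by
          rw [intervalIntegral.integral_const_mul]
          gcongr
          exact integral_exp_neg_mul_cos_le (exp_pos b)
      _ = _ := by
          rw [← Real.exp_neg, Real.exp_add, sub_mul, one_mul, sub_eq_add_neg, Real.exp_add]; ring
  have hGamma : Tendsto (fun b : ℝ => ∫ u in (0:ℝ)..rexp b, (u : ℂ) ^ (s - 1) * Complex.exp (-u))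
      atTop (𝓝 (Complex.Gamma s)) := by
    have := intervalIntegral_tendsto_integral_Ioi 0 (Complex.GammaIntegral_convergent hs)
      Real.tendsto_exp_atTop
    rw [Complex.Gamma_eq_integral hs, Complex.GammaIntegral]
    refine this.congr fun b => intervalIntegral.integral_congr fun u _ => ?_
    simp [mul_comm]
  have h := ((hGamma.add (hedge.const_mul Complex.I)).const_mul
    (Complex.exp (-(Complex.I * π * s / 2)))).comp Real.tendsto_log_atTop
  rw [mul_zero, add_zero] at h
  refine h.congr' ?_
  filter_upwards [eventually_gt_atTop 0] with X hX
  have h1 := hsec (Real.log X)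
  rw [hrot, Real.exp_log hX] at h1
  simp only [Function.comp, Real.exp_log hX]
  have h2 : Complex.exp (-(Complex.I * π * s / 2)) *
      Complex.exp (s * ((π / 2 : ℝ) * Complex.I)) = 1 := by
    rw [← Complex.exp_add, ← Complex.exp_zero]; push_cast; ring_nf
  have h3 : ∀ u : ℝ, Complex.exp (-(Complex.I * u)) = Complex.exp (-(u * Complex.I)) := fun u => by
    rw [mul_comm]
  simp only [h3]
  linear_combination Complex.exp (-(Complex.I * π * s / 2)) * h1 +
    (∫ u in (0:ℝ)..X, (u : ℂ) ^ (s - 1) * Complex.exp (-(u * Complex.I))) * h2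

lemma tendsto_integral_cpow_mul_exp_I {s : ℂ} (hs : 0 < s.re) (hs1 : s.re < 1) :
    Tendsto (fun X : ℝ => ∫ u in (0:ℝ)..X, (u : ℂ) ^ (s - 1) * Complex.exp (Complex.I * u))
      atTop (𝓝 (Complex.exp (Complex.I * π * s / 2) * Complex.Gamma s)) := by
  have h := (Complex.continuous_conj.tendsto _).comp (tendsto_integral_cpow_mul_exp_neg_I
    (s := (starRingEnd ℂ) s) (by simpa using hs) (by simpa using hs1))
  rw [map_mul, ← Complex.Gamma_conj, ← Complex.exp_conj] at h
  simp only [map_neg, map_div₀, map_mul, Complex.conj_conj, Complex.conj_I, Complex.conj_ofReal,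
    map_ofNat, neg_mul, neg_div, neg_neg] at h
  refine h.congr' ?_
  filter_upwards [eventually_ge_atTop 0] with X hX
  simp only [Function.comp]
  rw [intervalIntegral.integral_of_le hX, intervalIntegral.integral_of_le hX, ← integral_conj]
  refine setIntegral_congr_fun measurableSet_Ioc fun u hu => ?_
  simp only [map_mul, ← Complex.exp_conj, map_neg, Complex.conj_I, Complex.conj_ofReal]
  have h1 := Complex.cpow_conj u (s - 1) (by
    rw [Complex.arg_ofReal_of_nonneg hu.1.le]; exact pi_pos.ne)
  rw [map_sub, map_one, Complex.conj_ofReal] at h1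
  rw [h1, Complex.conj_conj]
  simp

/-- The truncated Mellin transform of `u ↦ exp (e * u)`. -/
noncomputable def oscPrimitive (e s : ℂ) (X : ℝ) : ℂ :=
  ∫ u in (0:ℝ)..X, (u : ℂ) ^ (s - 1) * Complex.exp (e * u)

lemma intervalIntegrable_cpow_mul_exp {s : ℂ} (hs : 0 < s.re) (e : ℂ) (a b : ℝ) :
    IntervalIntegrable (fun u : ℝ => (u : ℂ) ^ (s - 1) * Complex.exp (e * u)) volume a b :=
  (intervalIntegral.intervalIntegrable_cpow' (by simpa using hs)).mul_continuousOn
    (Continuous.continuousOn (by fun_prop))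

lemma continuous_oscPrimitive {s : ℂ} (hs : 0 < s.re) (e : ℂ) : Continuous (oscPrimitive e s) :=
  intervalIntegral.continuous_primitive (intervalIntegrable_cpow_mul_exp hs e) 0

lemma exists_norm_oscPrimitive_le {s e K : ℂ} (hs : 0 < s.re)
    (hK : Tendsto (oscPrimitive e s) atTop (𝓝 K)) :
    ∃ C, ∀ X, 0 ≤ X → ‖oscPrimitive e s X‖ ≤ C := by
  obtain ⟨A, hA⟩ := eventually_atTop.1 (hK.norm.eventually_le_const (lt_add_one ‖K‖))
  obtain ⟨C, hC⟩ := (isCompact_Icc (a := (0:ℝ)) (b := A)).exists_bound_of_continuousOn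
    (continuous_oscPrimitive hs e).continuousOn
  refine ⟨max C (‖K‖ + 1), fun X hX => ?_⟩
  rcases le_total X A with h | h
  · exact (hC X ⟨hX, h⟩).trans (le_max_left _ _)
  · exact (hA X h).trans (le_max_right _ _)

lemma cpow_mul_cpow_sub_one {c : ℝ} (hc : 0 < c) (s : ℂ) :
    (c : ℂ) ^ (s - 1) = (c : ℂ) ^ s * (c : ℂ)⁻¹ := by
  rw [Complex.cpow_sub _ _ (by exact_mod_cast hc.ne'), Complex.cpow_one, div_eq_mul_inv]

lemma integral_cpow_mul_exp_mul (e s : ℂ) {c : ℝ} (hc : 0 < c) {a b : ℝ} (ha : 0 ≤ a)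
    (hb : 0 ≤ b) :
    ∫ r in a..b, (r : ℂ) ^ (s - 1) * Complex.exp (e * (c * r)) =
      (c : ℂ) ^ (-s) * ∫ u in (c * a)..(c * b), (u : ℂ) ^ (s - 1) * Complex.exp (e * u) := by
  have hc0 : (c : ℂ) ≠ 0 := by exact_mod_cast hc.ne'
  have h := intervalIntegral.integral_comp_mul_left (a := a) (b := b)
    (fun u : ℝ => (u : ℂ) ^ (s - 1) * Complex.exp (e * u)) hc.ne'
  have h2 : ∫ r in a..b, ((c * r : ℝ) : ℂ) ^ (s - 1) * Complex.exp (e * (c * r : ℝ)) =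
      (c : ℂ) ^ (s - 1) * ∫ r in a..b, (r : ℂ) ^ (s - 1) * Complex.exp (e * (c * r)) := by
    rw [← intervalIntegral.integral_const_mul]
    refine intervalIntegral.integral_congr fun r hr => ?_
    have hr0 : 0 ≤ r := (le_min ha hb).trans hr.1
    rw [Complex.ofReal_mul, Complex.mul_cpow_ofReal_nonneg hc.le hr0, mul_assoc]
  rw [h2, cpow_mul_cpow_sub_one hc, Complex.real_smul] at h
  rw [Complex.cpow_neg]
  have : (c : ℂ) ^ s ≠ 0 := fun h0 => hc0 ((Complex.cpow_eq_zero_iff _ _).1 h0).1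
  field_simp
  push_cast at h
  field_simp at h
  rw [mul_comm] at h
  simpa only [mul_comm (c : ℂ) e] using h

lemma integral_cpow_mul_exp_mul_zero (e s : ℂ) {c R : ℝ} (hc : 0 < c) (hR : 0 ≤ R) :
    ∫ r in (0:ℝ)..R, (r : ℂ) ^ (s - 1) * Complex.exp (e * (c * r)) =
      (c : ℂ) ^ (-s) * oscPrimitive e s (c * R) := by
  rw [integral_cpow_mul_exp_mul e s hc le_rfl hR, mul_zero, oscPrimitive]

lemma tendsto_integral_mul_oscillatory {s e K : ℂ} (hs : 0 < s.re)
    (hK : Tendsto (oscPrimitive e s) atTop (𝓝 K)) {μ : Measure ℝ} {p : ℝ → ℂ} {c : ℝ → ℝ}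
    (hc : Measurable c) (hc0 : ∀ᵐ x ∂μ, 0 < c x)
    (hp : Integrable (fun x => p x * (c x : ℂ) ^ (-s)) μ) :
    Tendsto (fun R : ℝ => ∫ x, p x *
        (∫ r in (0:ℝ)..R, (r : ℂ) ^ (s - 1) * Complex.exp (e * (c x * r))) ∂μ)
      atTop (𝓝 (K * ∫ x, p x * (c x : ℂ) ^ (-s) ∂μ)) := by
  obtain ⟨C, hC⟩ := exists_norm_oscPrimitive_le hs hK
  have hlim : Tendsto (fun R : ℝ => ∫ x, p x * (c x : ℂ) ^ (-s) * oscPrimitive e s (c x * R) ∂μ)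
      atTop (𝓝 (∫ x, p x * (c x : ℂ) ^ (-s) * K ∂μ)) := by
    refine tendsto_integral_filter_of_dominated_convergence
      (fun x => ‖p x * (c x : ℂ) ^ (-s)‖ * C) ?_ ?_ (hp.norm.mul_const C) ?_
    · refine Eventually.of_forall fun R => hp.aestronglyMeasurable.mul ?_
      exact ((continuous_oscPrimitive hs e).measurable.comp
        (hc.mul_const R)).aestronglyMeasurable
    · filter_upwards [eventually_ge_atTop 0] with R hR
      filter_upwards [hc0] with x hx
      rw [norm_mul]
      exact mul_le_mul_of_nonneg_left (hC _ (by positivity)) (norm_nonneg _)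
    · filter_upwards [hc0] with x hx
      exact (hK.comp (tendsto_id.const_mul_atTop hx)).const_mul _
  rw [integral_mul_const, mul_comm] at hlim
  refine hlim.congr' ?_
  filter_upwards [eventually_ge_atTop 0] with R hR
  refine integral_congr_ae ?_
  filter_upwards [hc0] with x hx
  rw [integral_cpow_mul_exp_mul_zero e s hx hR, mul_assoc]

lemma integral_mul_intervalIntegral_oscillatory_swap {s e : ℂ} (hs : 0 < s.re) (he : e.re = 0)
    {μ : Measure ℝ} [SFinite μ] {p : ℝ → ℂ} {c : ℝ → ℝ} (hc : Measurable c)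
    (hp : Integrable p μ) {R : ℝ} (hR : 0 ≤ R) :
    ∫ x, p x * (∫ r in (0:ℝ)..R, (r : ℂ) ^ (s - 1) * Complex.exp (e * (c x * r))) ∂μ =
      ∫ r in (0:ℝ)..R, (r : ℂ) ^ (s - 1) * ∫ x, p x * Complex.exp (e * (c x * r)) ∂μ := by
  have hint : Integrable (Function.uncurry fun (r x : ℝ) =>
      ((r : ℂ) ^ (s - 1) * p x) * Complex.exp (e * (c x * r)))
      ((volume.restrict (Set.uIoc 0 R)).prod μ) := by
    have h1 : Integrable (fun r : ℝ => (r : ℂ) ^ (s - 1)) (volume.restrict (Set.uIoc 0 R)) := by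
      have : IntervalIntegrable (fun u : ℝ => (u : ℂ) ^ (s - 1)) volume 0 R :=
        intervalIntegral.intervalIntegrable_cpow' (by simpa using hs)
      rw [Set.uIoc_of_le hR]
      rwa [intervalIntegrable_iff_integrableOn_Ioc_of_le hR] at this
    refine (h1.mul_prod hp).mul_bdd (c := 1) ?_ (ae_of_all _ fun z => ?_)
    · exact Measurable.aestronglyMeasurable (by fun_prop)
    · rw [Complex.norm_exp]
      simp [he]
  have h := intervalIntegral_integral_swap hint
  simp only [mul_assoc, integral_const_mul] at h
  rw [h]
  refine integral_congr_ae (ae_of_all _ fun x => ?_)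
  simp only
  rw [← intervalIntegral.integral_const_mul]
  refine intervalIntegral.integral_congr fun r _ => ?_
  ring

lemma integrableOn_cos_rpow_neg {σ : ℝ} (hσ0 : 0 ≤ σ) (hσ : σ < 1) :
    IntegrableOn (fun θ : ℝ => Real.cos θ ^ (-σ)) (Set.Ioo 0 (π / 2)) := by
  have h1 : IntegrableOn (fun θ : ℝ => (1 - 2 / π * θ) ^ (-σ)) (Set.Ioo 0 (π / 2)) := by
    have h := (intervalIntegral.intervalIntegrable_rpow' (a := 0) (b := 1) (r := -σ)
      (by linarith)).symm
    have h2 := (h.comp_sub_left 1).comp_mul_left (c := 2 / π)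
    have hpi : π / 2 = 1 / (2 / π) := by field_simp
    rw [hpi]
    rw [sub_self, sub_zero, zero_div,
      intervalIntegrable_iff_integrableOn_Ioo_of_le (by positivity)] at h2
    exact h2
  refine h1.mono' (by
    refine ContinuousOn.aestronglyMeasurable ?_ measurableSet_Ioo
    refine Real.continuous_cos.continuousOn.rpow_const fun θ hθ => Or.inl ?_
    exact (Real.cos_pos_of_mem_Ioo ⟨by linarith [hθ.1, pi_pos], hθ.2⟩).ne') ?_
  refine (ae_restrict_iff' measurableSet_Ioo).2 (ae_of_all _ fun θ hθ => ?_)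
  have hpos : 0 < 1 - 2 / π * θ := by
    have := hθ.2
    have hpi := pi_pos
    rw [sub_pos, div_mul_eq_mul_div, div_lt_one hpi]
    linarith
  have hle := Real.one_sub_mul_le_cos hθ.1.le hθ.2.le
  rw [Real.norm_of_nonneg (rpow_nonneg (hpos.le.trans hle) _)]
  exact Real.rpow_le_rpow_of_nonpos hpos hle (by linarith)

lemma integrableOn_mul_two_cos_cpow {s : ℂ} (hs : 0 < s.re) (hs1 : s.re < 1) {p : ℝ → ℂ}
    (hp : Continuous p) :
    IntegrableOn (fun θ : ℝ => p θ * ((2 * Real.cos θ : ℝ) : ℂ) ^ (-s)) (Set.Ioo 0 (π / 2)) := by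
  have hbd : IntegrableOn (fun θ : ℝ => ((2 * Real.cos θ : ℝ) : ℂ) ^ (-s)) (Set.Ioo 0 (π / 2)) := by
    have hcos : ∀ θ ∈ Set.Ioo 0 (π / 2), 0 < Real.cos θ := fun θ hθ =>
      Real.cos_pos_of_mem_Ioo ⟨by linarith [hθ.1, pi_pos], hθ.2⟩
    refine ((integrableOn_cos_rpow_neg hs.le hs1).const_mul (2 ^ (-s.re))).mono' ?_ ?_
    · refine ContinuousOn.aestronglyMeasurable (fun θ hθ => ?_) measurableSet_Ioo
      refine ContinuousAt.continuousWithinAt ?_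
      exact (Complex.continuousAt_ofReal_cpow_const _ _ (Or.inr (by
        have := hcos θ hθ; positivity))).comp (f := fun θ : ℝ => 2 * Real.cos θ) (by fun_prop)
    · refine (ae_restrict_iff' measurableSet_Ioo).2 (ae_of_all _ fun θ hθ => ?_)
      have := hcos θ hθ
      rw [Complex.norm_cpow_eq_rpow_re_of_pos (by positivity), Complex.neg_re,
        Real.mul_rpow (by norm_num) this.le]
  obtain ⟨C, hC⟩ := (isCompact_Icc (a := (0:ℝ)) (b := π / 2)).exists_bound_of_continuousOn
    hp.continuousOn
  exact hbd.bdd_mul hp.aestronglyMeasurable ((ae_restrict_iff' measurableSet_Ioo).2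
    (ae_of_all _ fun θ hθ => hC θ (Set.Ioo_subset_Icc_self hθ)))

lemma tendsto_integral_quarter_circle {s e K : ℂ} (hs : 0 < s.re) (hs1 : s.re < 1) (he : e.re = 0)
    (hK : Tendsto (oscPrimitive e s) atTop (𝓝 K)) {p : ℝ → ℂ} (hp : Continuous p) :
    Tendsto (fun R : ℝ => ∫ r in (0:ℝ)..R, (r : ℂ) ^ (s - 1) *
        ∫ θ in (0:ℝ)..(π / 2), p θ * Complex.exp (e * ((2 * Real.cos θ : ℝ) * r)))
      atTop (𝓝 (K * ∫ θ in (0:ℝ)..(π / 2), p θ * ((2 * Real.cos θ : ℝ) : ℂ) ^ (-s))) := by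
  have h := tendsto_integral_mul_oscillatory hs hK (μ := volume.restrict (Set.Ioo 0 (π / 2)))
    (p := p) (c := fun θ => 2 * Real.cos θ) (by fun_prop)
    ((ae_restrict_iff' measurableSet_Ioo).2 (ae_of_all _ fun θ hθ => by
      have := Real.cos_pos_of_mem_Ioo (x := θ) ⟨by linarith [hθ.1, pi_pos], hθ.2⟩
      positivity)) (integrableOn_mul_two_cos_cpow hs hs1 hp)
  simp only [intervalIntegral.integral_of_le (show (0:ℝ) ≤ π / 2 by positivity),
    integral_Ioc_eq_integral_Ioo]
  refine h.congr' ?_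
  filter_upwards [eventually_ge_atTop 0] with R hR
  exact integral_mul_intervalIntegral_oscillatory_swap hs he (by fun_prop)
    (((hp.integrableOn_Icc (a := 0) (b := π / 2)).mono_set Set.Ioo_subset_Icc_self)) hR

lemma tendsto_integral_tail {γ e K : ℂ} (hγ : 0 < γ.re) (hK : Tendsto (oscPrimitive e γ) atTop (𝓝 K))
    (v : ℝ) :
    Tendsto (fun T : ℝ => ∫ u in v..T, (u : ℂ) ^ (γ - 1) * Complex.exp (e * u)) atTop
      (𝓝 (K - oscPrimitive e γ v)) := by
  refine (hK.sub_const _).congr fun T => ?_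
  exact intervalIntegral.integral_interval_sub_left (intervalIntegrable_cpow_mul_exp hγ e 0 T)
    (intervalIntegrable_cpow_mul_exp hγ e 0 v)

lemma integrableOn_Ioi_cpow_mul_one_add_cpow {γ s : ℂ} (hs : 0 < s.re) (hγs : γ.re < s.re) :
    IntegrableOn (fun w : ℝ => (w : ℂ) ^ (γ - 1) * ((1 + w : ℝ) : ℂ) ^ (-s)) (Set.Ioi 1) := by
  refine (integrableOn_Ioi_rpow_of_lt (a := γ.re - 1 - s.re) (by linarith)
    one_pos).mono' ?_ ((ae_restrict_iff' measurableSet_Ioi).2 (ae_of_all _ fun w hw => ?_))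
  · exact Measurable.aestronglyMeasurable (by fun_prop)
  · have hw0 : (0:ℝ) < w := one_pos.trans hw
    rw [norm_mul, Complex.norm_cpow_eq_rpow_re_of_pos hw0,
      Complex.norm_cpow_eq_rpow_re_of_pos (by linarith), sub_eq_add_neg (γ.re - 1),
      Real.rpow_add hw0]
    simp only [Complex.sub_re, Complex.one_re, Complex.neg_re]
    refine mul_le_mul_of_nonneg_left ?_ (by positivity)
    exact Real.rpow_le_rpow_of_nonpos hw0 (by linarith) (by linarith)

lemma integral_mul_oscPrimitive_sub {γ δ : ℂ} (hγ : 0 < γ.re) (hδ : 0 < δ.re) {V W : ℝ}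
    (hV : 0 ≤ V) (hW : 1 ≤ W) :
    ∫ v in (0:ℝ)..V, (v : ℂ) ^ (δ - 1) * Complex.exp (Complex.I * v) *
        (oscPrimitive Complex.I γ (v * W) - oscPrimitive Complex.I γ v) =
      ∫ w in (1:ℝ)..W, (w : ℂ) ^ (γ - 1) *
        (∫ v in (0:ℝ)..V, (v : ℂ) ^ (γ + δ - 1) * Complex.exp (Complex.I * ((1 + w : ℝ) * v))) := by
  have hp : Integrable (fun w : ℝ => (w : ℂ) ^ (γ - 1)) (volume.restrict (Set.Ioc 1 W)) := by
    have := intervalIntegral.intervalIntegrable_cpow' (a := 1) (b := W) (r := γ - 1) (by simpa using hγ)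
    rwa [intervalIntegrable_iff_integrableOn_Ioc_of_le hW] at this
  rw [intervalIntegral.integral_of_le hW, integral_mul_intervalIntegral_oscillatory_swap
    (s := γ + δ) (e := Complex.I) (c := fun w => 1 + w) (by simp; linarith) Complex.I_re (by fun_prop) hp hV,
    intervalIntegral.integral_of_le hV, intervalIntegral.integral_of_le hV]
  refine setIntegral_congr_fun measurableSet_Ioc fun v hv => ?_
  have hv0 : (v : ℂ) ≠ 0 := by exact_mod_cast hv.1.ne'
  have h1 := integral_cpow_mul_exp_mul Complex.I γ hv.1 zero_le_one (zero_le_one.trans hW)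
  rw [mul_one, ← intervalIntegral.integral_interval_sub_left
    (intervalIntegrable_cpow_mul_exp hγ Complex.I 0 (v * W))
    (intervalIntegrable_cpow_mul_exp hγ Complex.I 0 v)] at h1
  have h2 : ∫ w in Set.Ioc 1 W, (w : ℂ) ^ (γ - 1) * Complex.exp (Complex.I * ((1 + w : ℝ) * v)) =
      Complex.exp (Complex.I * v) *
        ∫ w in (1:ℝ)..W, (w : ℂ) ^ (γ - 1) * Complex.exp (Complex.I * (v * w)) := by
    rw [intervalIntegral.integral_of_le hW, ← integral_const_mul]
    refine integral_congr_ae (ae_of_all _ fun w => ?_)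
    simp only
    rw [mul_left_comm (Complex.exp _), ← Complex.exp_add]
    push_cast
    ring_nf
  rw [h2, h1, show γ + δ - 1 = (δ - 1) + γ by ring, Complex.cpow_add _ _ hv0, Complex.cpow_neg]
  have : (v : ℂ) ^ γ ≠ 0 := fun h0 => hv0 ((Complex.cpow_eq_zero_iff _ _).1 h0).1
  simp only [oscPrimitive]
  field_simp

lemma integral_mul_oscillatory_tail {γ δ Kγ K : ℂ} (hγ : 0 < γ.re) (hδ : 0 < δ.re)
    (hKγ : Tendsto (oscPrimitive Complex.I γ) atTop (𝓝 Kγ))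
    (hK : Tendsto (oscPrimitive Complex.I (γ + δ)) atTop (𝓝 K)) {V : ℝ} (hV : 0 ≤ V) :
    ∫ v in (0:ℝ)..V, (v : ℂ) ^ (δ - 1) * Complex.exp (Complex.I * v) *
        (Kγ - oscPrimitive Complex.I γ v) =
      ∫ w in Set.Ioi (1:ℝ), (w : ℂ) ^ (γ - 1) *
        (∫ v in (0:ℝ)..V, (v : ℂ) ^ (γ + δ - 1) * Complex.exp (Complex.I * ((1 + w : ℝ) * v))) := by
  have hs : 0 < (γ + δ).re := by simp; linarith
  obtain ⟨C, hC⟩ := exists_norm_oscPrimitive_le hγ hKγ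
  obtain ⟨D, hD⟩ := exists_norm_oscPrimitive_le hs hK
  have hright : Tendsto (fun W : ℝ => ∫ w in (1:ℝ)..W, (w : ℂ) ^ (γ - 1) *
      (∫ v in (0:ℝ)..V, (v : ℂ) ^ (γ + δ - 1) * Complex.exp (Complex.I * ((1 + w : ℝ) * v))))
      atTop (𝓝 (∫ w in Set.Ioi (1:ℝ), (w : ℂ) ^ (γ - 1) *
        (∫ v in (0:ℝ)..V, (v : ℂ) ^ (γ + δ - 1) * Complex.exp (Complex.I * ((1 + w : ℝ) * v))))) := by
    refine intervalIntegral_tendsto_integral_Ioi 1 ?_ tendsto_id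
    have hb : IntegrableOn (fun w : ℝ => ((w : ℂ) ^ (γ - 1) * ((1 + w : ℝ) : ℂ) ^ (-(γ + δ))) *
        oscPrimitive Complex.I (γ + δ) ((1 + w) * V)) (Set.Ioi 1) := by
      refine Integrable.mul_bdd (c := D) (integrableOn_Ioi_cpow_mul_one_add_cpow hs (by simpa)) ?_
        ((ae_restrict_iff' measurableSet_Ioi).2 (ae_of_all _ fun w hw => hD _ ?_))
      · exact ((continuous_oscPrimitive hs _).comp (by fun_prop)).aestronglyMeasurable
      · have : (1:ℝ) < w := hw
        positivity
    refine hb.congr_fun (fun w hw => ?_) measurableSet_Ioi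
    have hw' : (1:ℝ) < w := hw
    simp only
    rw [integral_cpow_mul_exp_mul_zero Complex.I (γ + δ) (by linarith : (0:ℝ) < 1 + w) hV, mul_assoc]
  have hleft : Tendsto (fun W : ℝ => ∫ v in (0:ℝ)..V, (v : ℂ) ^ (δ - 1) *
      Complex.exp (Complex.I * v) * (oscPrimitive Complex.I γ (v * W) - oscPrimitive Complex.I γ v))
      atTop (𝓝 (∫ v in (0:ℝ)..V, (v : ℂ) ^ (δ - 1) * Complex.exp (Complex.I * v) *
        (Kγ - oscPrimitive Complex.I γ v))) := by
    have hi := intervalIntegrable_cpow_mul_exp hδ Complex.I 0 V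
    refine intervalIntegral.tendsto_integral_filter_of_dominated_convergence
      (fun v => ‖(v : ℂ) ^ (δ - 1) * Complex.exp (Complex.I * v)‖ * (C + C)) ?_ ?_
      (hi.norm.mul_const _) ?_
    · refine Eventually.of_forall fun W => ?_
      refine (intervalIntegrable_iff.1 hi).aestronglyMeasurable.mul ?_
      exact (((continuous_oscPrimitive hγ _).comp (by fun_prop)).sub
        (continuous_oscPrimitive hγ _)).aestronglyMeasurable
    · filter_upwards [eventually_ge_atTop 0] with W hW
      refine ae_of_all _ fun v hv => ?_
      rw [Set.uIoc_of_le hV] at hv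
      rw [norm_mul]
      refine mul_le_mul_of_nonneg_left ((norm_sub_le _ _).trans (add_le_add (hC _ ?_) (hC _ hv.1.le)))
        (norm_nonneg _)
      exact mul_nonneg hv.1.le hW
    · refine ae_of_all _ fun v hv => ?_
      rw [Set.uIoc_of_le hV] at hv
      exact ((hKγ.comp (tendsto_id.const_mul_atTop hv.1)).sub_const _).const_mul _
  refine tendsto_nhds_unique hleft (hright.congr' ?_)
  filter_upwards [eventually_ge_atTop 1] with W hW
  exact (integral_mul_oscPrimitive_sub hγ hδ hV hW).symm

lemma tendsto_integral_mul_oscillatory_tail {γ δ Kγ K : ℂ} (hγ : 0 < γ.re) (hδ : 0 < δ.re)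
    (hKγ : Tendsto (oscPrimitive Complex.I γ) atTop (𝓝 Kγ))
    (hK : Tendsto (oscPrimitive Complex.I (γ + δ)) atTop (𝓝 K)) :
    Tendsto (fun V : ℝ => ∫ v in (0:ℝ)..V, (v : ℂ) ^ (δ - 1) * Complex.exp (Complex.I * v) *
        (Kγ - oscPrimitive Complex.I γ v)) atTop
      (𝓝 (K * ∫ w in Set.Ioi (1:ℝ), (w : ℂ) ^ (γ - 1) * ((1 + w : ℝ) : ℂ) ^ (-(γ + δ)))) := by
  have hs : 0 < (γ + δ).re := by simp; linarith
  have h := tendsto_integral_mul_oscillatory hs hK (μ := volume.restrict (Set.Ioi 1))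
    (p := fun w : ℝ => (w : ℂ) ^ (γ - 1)) (c := fun w => 1 + w) (by fun_prop)
    ((ae_restrict_iff' measurableSet_Ioi).2 (ae_of_all _ fun w (hw : 1 < w) => by linarith))
    (integrableOn_Ioi_cpow_mul_one_add_cpow hs (by simpa))
  refine h.congr' ?_
  filter_upwards [eventually_ge_atTop 0] with V hV
  exact (integral_mul_oscillatory_tail hγ hδ hKγ hK hV).symm

lemma norm_cpow_neg_le {z s : ℂ} (hs : 0 ≤ s.re) {c : ℝ} (hc : 0 < c) (hz : c ≤ ‖z‖) :
    ‖z ^ (-s)‖ ≤ c ^ (-s.re) * rexp (π * |s.im|) := by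
  refine (Complex.norm_cpow_le _ _).trans ?_
  rw [div_eq_mul_inv, ← Real.exp_neg, Complex.neg_re, Complex.neg_im]
  refine mul_le_mul (Real.rpow_le_rpow_of_nonpos hc hz (by linarith)) (exp_le_exp.2 ?_)
    (exp_pos _).le (by positivity)
  rw [mul_neg, neg_neg]
  refine (le_abs_self _).trans ?_
  rw [abs_mul]
  exact mul_le_mul_of_nonneg_right (Complex.abs_arg_le_pi _) (abs_nonneg _)

lemma cos_half_le_norm_one_add_exp (b : ℝ) {θ : ℝ} (hθ : θ ∈ Set.Ioo 0 π) :
    Real.cos (θ / 2) ≤ ‖1 + Complex.exp (b + θ * Complex.I)‖ := by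
  have hcos : 0 < Real.cos (θ / 2) :=
    Real.cos_pos_of_mem_Ioo ⟨by linarith [hθ.1, pi_pos], by linarith [hθ.2]⟩
  have h1 : 1 + Complex.exp (b + θ * Complex.I) = Complex.exp ((θ / 2 : ℝ) * Complex.I) *
      (Complex.exp ((-(θ / 2) : ℝ) * Complex.I) + rexp b * Complex.exp ((θ / 2 : ℝ) * Complex.I)) := by
    rw [mul_add, ← Complex.exp_add, mul_left_comm, ← Complex.exp_add, Complex.exp_add (b : ℂ),
      ← add_mul, ← add_mul, ← Complex.ofReal_add, ← Complex.ofReal_add, Complex.ofReal_exp]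
    simp
  rw [h1, norm_mul, Complex.norm_exp_ofReal_mul_I, one_mul]
  refine le_trans ?_ (Complex.re_le_norm _)
  rw [Complex.add_re, Complex.re_ofReal_mul, Complex.exp_ofReal_mul_I_re,
    Complex.exp_ofReal_mul_I_re, Real.cos_neg]
  have := mul_pos (exp_pos b) hcos
  linarith

lemma integral_cpow_mul_one_add_cpow_sub {γ s : ℂ} (hγ : 0 < γ.re) (hs : 0 < s.re) (hs1 : s.re < 1) :
    (∫ u in (0:ℝ)..1, (u : ℂ) ^ (γ - 1) * (1 + u : ℂ) ^ (-s)) -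
      Complex.exp (γ * (π * Complex.I)) * Complex.betaIntegral γ (1 - s) +
      Complex.I * (∫ θ in (0:ℝ)..π, Complex.exp (γ * (θ * Complex.I)) *
        (1 + Complex.exp (θ * Complex.I)) ^ (-s)) = 0 := by
  have hlt : ∀ b : ℝ, b < 0 → ∀ w ∈ Set.Iic b ×ℂ Set.uIcc 0 π, 1 - rexp b ≤ (1 + Complex.exp w).re := by
    intro b hb w hw
    rw [Complex.mem_reProdIm] at hw
    have h1 : rexp w.re ≤ rexp b := exp_le_exp.2 hw.1
    have h2 := (Complex.abs_re_le_norm (Complex.exp w)).trans (Complex.norm_exp w ▸ h1)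
    rw [Complex.add_re, Complex.one_re]
    linarith [neg_le_of_abs_le h2]
  have hsec : ∀ b : ℝ, b < 0 → _ := fun b hb => integral_sector_zero_eq_zero hγ (fun z => (1 + z) ^ (-s)) b π
    ((1 - rexp b) ^ (-s.re) * rexp (π * |s.im|)) (by
      refine DifferentiableOn.cpow_const (by fun_prop) fun w hw => Or.inl ?_
      have := hlt b hb w hw
      have := Real.exp_lt_one_iff.2 hb
      linarith) (by
      intro w hw
      refine norm_cpow_neg_le hs.le (by have := Real.exp_lt_one_iff.2 hb; linarith)
        ((hlt b hb w hw).trans (Complex.re_le_norm _)))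
  have hexp : Tendsto rexp (𝓝[<] 0) (𝓝[Set.uIcc 0 1] 1) := by
    refine tendsto_nhdsWithin_iff.2 ⟨?_, ?_⟩
    · simpa using (Real.continuous_exp.tendsto 0).mono_left nhdsWithin_le_nhds
    · filter_upwards [self_mem_nhdsWithin] with b hb
      rw [Set.uIcc_of_le zero_le_one]
      exact ⟨(exp_pos b).le, (Real.exp_lt_one_iff.2 hb).le⟩
  have hprim : ∀ f : ℝ → ℂ, IntervalIntegrable f volume 0 1 →
      Tendsto (fun b : ℝ => ∫ u in (0:ℝ)..rexp b, f u) (𝓝[<] 0) (𝓝 (∫ u in (0:ℝ)..1, f u)) := by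
    intro f hf
    have h1 := intervalIntegral.continuousOn_primitive_interval (f := f) (μ := volume) (a := 0)
      (b := 1) (by
        rw [Set.uIcc_of_le zero_le_one]
        rwa [intervalIntegrable_iff_integrableOn_Icc_of_le zero_le_one] at hf)
    exact Tendsto.comp (h1 1 Set.right_mem_uIcc) hexp
  have hpos : IntervalIntegrable (fun u : ℝ => (u : ℂ) ^ (γ - 1) * (1 + u : ℂ) ^ (-s)) volume 0 1 := by
    refine intervalIntegrable_cpow_mul_of_bdd hγ (h := fun u : ℝ => (1 + u : ℂ) ^ (-s)) zero_le_one
      (C := 1 ^ (-s.re) * rexp (π * |s.im|)) ?_ ?_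
    · refine ContinuousOn.cpow_const (by fun_prop) fun u hu => Or.inl ?_
      have := hu.1
      simp only [Complex.add_re, Complex.one_re, Complex.ofReal_re]
      linarith
    · intro u hu
      refine norm_cpow_neg_le hs.le one_pos (le_trans ?_ (Complex.re_le_norm _))
      simpa using hu.1.le
  have hneg := Complex.betaIntegral_convergent (u := γ) (v := 1 - s) hγ (by simpa using hs1)
  have hedge : Tendsto (fun b : ℝ => ∫ θ in (0:ℝ)..π, Complex.exp (γ * (b + θ * Complex.I)) *
      (1 + Complex.exp (b + θ * Complex.I)) ^ (-s)) (𝓝[<] 0)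
      (𝓝 (∫ θ in (0:ℝ)..π, Complex.exp (γ * (θ * Complex.I)) *
        (1 + Complex.exp (θ * Complex.I)) ^ (-s))) := by
    have hcos : IntegrableOn (fun θ : ℝ => Real.cos (θ / 2) ^ (-s.re)) (Set.Ioo 0 π) := by
      have h1 := (intervalIntegrable_iff_integrableOn_Ioo_of_le (by positivity)).2
        (integrableOn_cos_rpow_neg hs.le hs1)
      have h2 := h1.comp_mul_left (c := 2⁻¹)
      rw [zero_div, show π / 2 / 2⁻¹ = π by field_simp,
        intervalIntegrable_iff_integrableOn_Ioo_of_le (by positivity)] at h2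
      simpa only [inv_mul_eq_div] using h2
    simp only [intervalIntegral.integral_of_le pi_pos.le, integral_Ioc_eq_integral_Ioo]
    refine tendsto_integral_filter_of_dominated_convergence
      (fun θ => rexp (|γ.im| * π) * (Real.cos (θ / 2) ^ (-s.re) * rexp (π * |s.im|))) ?_ ?_
      ((hcos.mul_const _).const_mul _) ?_
    · exact Eventually.of_forall fun b => Measurable.aestronglyMeasurable (by fun_prop)
    · filter_upwards [self_mem_nhdsWithin] with b hb
      refine (ae_restrict_iff' measurableSet_Ioo).2 (ae_of_all _ fun θ hθ => ?_)
      rw [norm_mul, Complex.norm_exp]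
      refine mul_le_mul (exp_le_exp.2 ?_) (norm_cpow_neg_le hs.le ?_
        (cos_half_le_norm_one_add_exp b hθ)) (norm_nonneg _) (exp_pos _).le
      · have h1 : -(γ.im * θ) ≤ |γ.im| * π :=
          (neg_le_abs _).trans (by
            rw [abs_mul]; gcongr; rw [abs_of_pos hθ.1]; exact hθ.2.le)
        have h2 : γ.re * b ≤ 0 := mul_nonpos_of_nonneg_of_nonpos hγ.le (le_of_lt hb)
        have h3 : (γ * (b + θ * Complex.I)).re = γ.re * b + -(γ.im * θ) := by
          simp [sub_eq_add_neg]
        linarith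
      · exact Real.cos_pos_of_mem_Ioo ⟨by linarith [hθ.1, pi_pos], by linarith [hθ.2]⟩
    · refine (ae_restrict_iff' measurableSet_Ioo).2 (ae_of_all _ fun θ hθ => ?_)
      have hc : ContinuousAt (fun b : ℝ => Complex.exp (γ * (b + θ * Complex.I)) *
          (1 + Complex.exp (b + θ * Complex.I)) ^ (-s)) 0 := by
        refine ContinuousAt.mul (by fun_prop) (ContinuousAt.cpow (by fun_prop) continuousAt_const (Or.inl ?_))
        have h1 : 0 < Real.cos (θ / 2) :=
          Real.cos_pos_of_mem_Ioo ⟨by linarith [hθ.1, pi_pos], by linarith [hθ.2]⟩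
        have h2 : Real.cos θ = 2 * Real.cos (θ / 2) ^ 2 - 1 := by
          rw [← Real.cos_two_mul]; ring_nf
        rw [Complex.add_re, Complex.ofReal_zero, zero_add, Complex.exp_ofReal_mul_I_re, Complex.one_re, h2]
        nlinarith
      have := hc.tendsto.mono_left (nhdsWithin_le_nhds (s := Set.Iio 0))
      simpa using this
  refine tendsto_nhds_unique (f := fun _ : ℝ => (0:ℂ)) (l := 𝓝[<] 0) ?_ tendsto_const_nhds
  refine (((hprim _ hpos).sub ((hprim _ hneg).const_mul _)).add (hedge.const_mul Complex.I)).congr' ?_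
  filter_upwards [self_mem_nhdsWithin] with b hb
  have := hsec b hb
  simp only [Complex.exp_pi_mul_I, mul_neg_one, ← sub_eq_add_neg] at this
  rw [show 1 - s - 1 = -s by ring]
  exact this

lemma one_add_exp_cpow (s : ℂ) {θ : ℝ} (hθ : θ ∈ Set.Ioo 0 (π / 2)) :
    (1 + Complex.exp ((2 * θ : ℝ) * Complex.I)) ^ (-s) =
      ((2 * Real.cos θ : ℝ) : ℂ) ^ (-s) * Complex.exp (-(s * (θ * Complex.I))) := by
  have hcos : 0 < 2 * Real.cos θ := by
    have := Real.cos_pos_of_mem_Ioo (x := θ) ⟨by linarith [hθ.1, pi_pos], hθ.2⟩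
    positivity
  have h1 : 1 + Complex.exp ((2 * θ : ℝ) * Complex.I) =
      (2 * Real.cos θ : ℝ) * Complex.exp (θ * Complex.I) := by
    rw [Complex.ofReal_mul 2 (Real.cos θ), Complex.ofReal_cos, Complex.ofReal_ofNat, Complex.two_cos, add_mul,
      ← Complex.exp_add, ← Complex.exp_add]
    push_cast
    ring_nf
    simp [add_comm]
  have hne : ((2 * Real.cos θ : ℝ) : ℂ) ≠ 0 := by exact_mod_cast hcos.ne'
  rw [h1, Complex.cpow_def_of_ne_zero (mul_ne_zero hne (Complex.exp_ne_zero _)),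
    Complex.log_ofReal_mul hcos (Complex.exp_ne_zero _), Complex.log_exp (by
      simp; linarith [hθ.1, pi_pos]) (by simp; linarith [hθ.2, pi_pos]),
    Complex.cpow_def_of_ne_zero hne, ← Complex.ofReal_log hcos.le, ← Complex.exp_add]
  ring_nf

lemma integral_two_cos_cpow {γ s : ℂ} (hγ : 0 < γ.re) (hs : 0 < s.re) (hs1 : s.re < 1) :
    2 * Complex.I * (∫ θ in (0:ℝ)..(π / 2), Complex.exp (Complex.I * (2 * γ - s) * θ) *
        ((2 * Real.cos θ : ℝ) : ℂ) ^ (-s)) =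
      Complex.exp (γ * (π * Complex.I)) * Complex.betaIntegral γ (1 - s) -
        ∫ u in (0:ℝ)..1, (u : ℂ) ^ (γ - 1) * (1 + u : ℂ) ^ (-s) := by
  have h := integral_cpow_mul_one_add_cpow_sub hγ hs hs1
  have h1 := intervalIntegral.integral_comp_mul_left (a := 0) (b := π / 2)
    (fun θ : ℝ => Complex.exp (γ * (θ * Complex.I)) * (1 + Complex.exp (θ * Complex.I)) ^ (-s))
    (two_ne_zero)
  rw [mul_zero, mul_div_cancel₀ _ two_ne_zero, Complex.real_smul] at h1
  have h2 : ∫ θ in (0:ℝ)..(π / 2), Complex.exp (γ * ((2 * θ : ℝ) * Complex.I)) *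
      (1 + Complex.exp ((2 * θ : ℝ) * Complex.I)) ^ (-s) =
      ∫ θ in (0:ℝ)..(π / 2), Complex.exp (Complex.I * (2 * γ - s) * θ) *
        ((2 * Real.cos θ : ℝ) : ℂ) ^ (-s) := by
    simp only [intervalIntegral.integral_of_le (show (0:ℝ) ≤ π / 2 by positivity),
      integral_Ioc_eq_integral_Ioo]
    refine setIntegral_congr_fun measurableSet_Ioo fun θ hθ => ?_
    rw [one_add_exp_cpow s hθ, mul_left_comm, ← Complex.exp_add, mul_comm]
    push_cast
    ring_nf
  rw [← h2, h1]
  push_cast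
  linear_combination h

lemma ofReal_cpow_eq_exp {x : ℝ} (hx : 0 < x) (a : ℂ) :
    (x : ℂ) ^ a = Complex.exp ((Real.log x : ℝ) * a) := by
  rw [Complex.cpow_def_of_ne_zero (by exact_mod_cast hx.ne'), Complex.ofReal_log hx.le]

lemma integral_beta_half (u v : ℂ) :
    ∫ x in (0:ℝ)..(1 / 2), (x : ℂ) ^ (u - 1) * (1 - x : ℂ) ^ (v - 1) =
      ∫ w in (0:ℝ)..1, (w : ℂ) ^ (u - 1) * (1 + w : ℂ) ^ (-(u + v)) := by
  have himg : (fun w : ℝ => w / (1 + w)) '' Set.Ioo 0 1 = Set.Ioo 0 (1 / 2) := by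
    ext x
    constructor
    · rintro ⟨w, ⟨h0, h1⟩, rfl⟩
      exact ⟨by positivity, by rw [div_lt_div_iff₀ (by linarith) two_pos]; linarith⟩
    · rintro ⟨h0, h1⟩
      have h2 : 0 < 1 - x := by linarith
      refine ⟨x / (1 - x), ⟨by positivity, by rw [div_lt_one h2]; linarith⟩, ?_⟩
      simp only
      field_simp
      ring
  have hderiv : ∀ w ∈ Set.Ioo (0:ℝ) 1,
      HasDerivWithinAt (fun w : ℝ => w / (1 + w)) (1 / (1 + w) ^ 2) (Set.Ioo 0 1) w := by
    intro w hw
    have := ((hasDerivAt_id w).div ((hasDerivAt_id w).const_add 1)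
      (by simp; linarith [hw.1])).hasDerivWithinAt (s := Set.Ioo 0 1)
    refine this.congr_deriv ?_
    simp
  have hinj : Set.InjOn (fun w : ℝ => w / (1 + w)) (Set.Ioo 0 1) := by
    intro a ha b hb hab
    have h1 : 0 < 1 + a := by linarith [ha.1]
    have h2 : 0 < 1 + b := by linarith [hb.1]
    simp only at hab
    rw [div_eq_div_iff h1.ne' h2.ne'] at hab
    linarith
  rw [intervalIntegral.integral_of_le (by norm_num), intervalIntegral.integral_of_le zero_le_one,
    integral_Ioc_eq_integral_Ioo, integral_Ioc_eq_integral_Ioo, ← himg,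
    integral_image_eq_integral_abs_deriv_smul measurableSet_Ioo hderiv hinj]
  refine setIntegral_congr_fun measurableSet_Ioo fun w hw => ?_
  have hw0 := hw.1
  have hw1 : 0 < 1 + w := by linarith
  have h1 : (1 - (w / (1 + w) : ℝ) : ℂ) = ((1 + w)⁻¹ : ℝ) := by
    rw [← Complex.ofReal_one, ← Complex.ofReal_sub]; congr 1; field_simp; ring
  have h2 : (1 + w : ℂ) = ((1 + w : ℝ) : ℂ) := by push_cast; rfl
  have h3 : |1 / (1 + w) ^ 2| = rexp (-(2 * Real.log (1 + w))) := by
    rw [abs_of_pos (by positivity), Real.exp_neg, two_mul, Real.exp_add, Real.exp_log hw1, one_div, sq]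
  rw [Complex.real_smul, h1, h2, ofReal_cpow_eq_exp (by positivity), ofReal_cpow_eq_exp (by positivity),
    ofReal_cpow_eq_exp (by positivity), ofReal_cpow_eq_exp (by positivity), h3, Complex.ofReal_exp,
    Real.log_div hw0.ne' hw1.ne', Real.log_inv, ← Complex.exp_add, ← Complex.exp_add, ← Complex.exp_add]
  push_cast
  ring_nf

lemma integral_Ioi_one_cpow_mul_one_add_cpow (γ δ : ℂ) :
    ∫ w in Set.Ioi (1:ℝ), (w : ℂ) ^ (γ - 1) * ((1 + w : ℝ) : ℂ) ^ (-(γ + δ)) =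
      ∫ x in (0:ℝ)..1, (x : ℂ) ^ (δ - 1) * (1 + x : ℂ) ^ (-(γ + δ)) := by
  have himg : (fun x : ℝ => x⁻¹) '' Set.Ioo 0 1 = Set.Ioi 1 := by
    ext x
    constructor
    · rintro ⟨w, ⟨h0, h1⟩, rfl⟩
      exact (one_lt_inv₀ h0).2 h1
    · intro (h1 : 1 < x)
      exact ⟨x⁻¹, ⟨by positivity, inv_lt_one_of_one_lt₀ h1⟩, inv_inv x⟩
  have hderiv : ∀ x ∈ Set.Ioo (0:ℝ) 1,
      HasDerivWithinAt (fun x : ℝ => x⁻¹) (-(x ^ 2)⁻¹) (Set.Ioo 0 1) x :=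
    fun x hx => (hasDerivAt_inv hx.1.ne').hasDerivWithinAt
  rw [intervalIntegral.integral_of_le zero_le_one, integral_Ioc_eq_integral_Ioo, ← himg,
    integral_image_eq_integral_abs_deriv_smul measurableSet_Ioo hderiv inv_injective.injOn]
  refine setIntegral_congr_fun measurableSet_Ioo fun x hx => ?_
  have hx0 := hx.1
  have hx1 : 0 < 1 + x := by linarith
  have h1 : 1 + x⁻¹ = (1 + x) / x := by field_simp; ring
  have h2 : (1 + x : ℂ) = ((1 + x : ℝ) : ℂ) := by push_cast; rfl
  have h3 : |-(x ^ 2)⁻¹| = rexp (-(2 * Real.log x)) := by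
    rw [abs_neg, abs_of_pos (by positivity), Real.exp_neg, two_mul, Real.exp_add, Real.exp_log hx0, sq]
  rw [Complex.real_smul, h1, h2, ofReal_cpow_eq_exp (by positivity), ofReal_cpow_eq_exp (by positivity),
    ofReal_cpow_eq_exp (by positivity), ofReal_cpow_eq_exp (by positivity), h3, Complex.ofReal_exp,
    Real.log_div hx1.ne' hx0.ne', Real.log_inv, ← Complex.exp_add, ← Complex.exp_add, ← Complex.exp_add]
  push_cast
  ring_nf

lemma betaIntegral_eq_add {u v : ℂ} (hu : 0 < u.re) (hv : 0 < v.re) :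
    Complex.betaIntegral u v =
      (∫ w in (0:ℝ)..1, (w : ℂ) ^ (u - 1) * (1 + w : ℂ) ^ (-(u + v))) +
      ∫ w in (0:ℝ)..1, (w : ℂ) ^ (v - 1) * (1 + w : ℂ) ^ (-(u + v)) := by
  have hint := Complex.betaIntegral_convergent hu hv
  have h1 := intervalIntegral.integral_comp_sub_left (a := 0) (b := 1 / 2)
    (fun x : ℝ => (x : ℂ) ^ (u - 1) * (1 - x : ℂ) ^ (v - 1)) 1
  rw [Complex.betaIntegral, ← intervalIntegral.integral_add_adjacent_intervals (b := 1 / 2)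
    (hint.mono_set (by
      rw [Set.uIcc_of_le, Set.uIcc_of_le] <;> norm_num; exact Set.Icc_subset_Icc_right (by norm_num)))
    (hint.mono_set (by
      rw [Set.uIcc_of_le, Set.uIcc_of_le] <;> norm_num; exact Set.Icc_subset_Icc_left (by norm_num))),
    integral_beta_half, add_comm u v, ← integral_beta_half v u, add_comm v u]
  congr 1
  rw [sub_zero, show (1:ℝ) - 1 / 2 = 1 / 2 by norm_num] at h1
  rw [← h1]
  refine intervalIntegral.integral_congr fun x _ => ?_
  push_cast
  rw [sub_sub_cancel, mul_comm]

lemma Gamma_mul_Gamma_one_sub_mul_sin {z : ℂ} (hz : 0 < z.re) (hz1 : z.re < 1) :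
    Complex.Gamma z * Complex.Gamma (1 - z) * Complex.sin (π * z) = π := by
  have h := Complex.Gamma_mul_Gamma_one_sub z
  have hsin : Complex.sin (π * z) ≠ 0 := by
    intro h0
    rw [h0, div_zero] at h
    exact mul_ne_zero (Complex.Gamma_ne_zero_of_re_pos hz)
      (Complex.Gamma_ne_zero_of_re_pos (by simpa using hz1)) h
  rw [h, div_mul_cancel₀ _ hsin]

lemma betaIntegral_one_sub_add {γ δ : ℂ} (hγ : 0 < γ.re) (hδ : 0 < δ.re)
    (hs1 : (γ + δ).re < 1) :
    (π : ℂ) * Complex.betaIntegral γ (1 - (γ + δ)) =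
      Complex.Gamma γ * Complex.Gamma δ * Complex.Gamma (1 - (γ + δ)) * Complex.sin (π * δ) := by
  simp only [Complex.add_re] at hs1
  have h := Complex.Gamma_mul_Gamma_eq_betaIntegral (s := γ) (t := 1 - (γ + δ)) hγ
    (by simp; linarith)
  rw [show γ + (1 - (γ + δ)) = 1 - δ by ring] at h
  linear_combination -(Complex.Gamma δ * Complex.sin (π * δ)) * h -
    Complex.betaIntegral γ (1 - (γ + δ)) *
      Gamma_mul_Gamma_one_sub_mul_sin hδ (by linarith)

lemma pi_mul_betaIntegral {γ δ : ℂ} (hγ : 0 < γ.re) (hδ : 0 < δ.re) (hs1 : (γ + δ).re < 1) :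
    (π : ℂ) * Complex.betaIntegral γ δ =
      Complex.Gamma γ * Complex.Gamma δ * Complex.Gamma (1 - (γ + δ)) *
        Complex.sin (π * (γ + δ)) := by
  have h := Complex.Gamma_mul_Gamma_eq_betaIntegral hγ hδ
  linear_combination -(Complex.Gamma (1 - (γ + δ)) * Complex.sin (π * (γ + δ))) * h -
    Complex.betaIntegral γ δ *
      Gamma_mul_Gamma_one_sub_mul_sin (z := γ + δ) (by simp; linarith) hs1

lemma integral_zero_two_pi_eq_quarters {f : ℝ → ℂ} (hf : Continuous f) :
    ∫ θ in (0:ℝ)..(2 * π), f θ =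
      ∫ θ in (0:ℝ)..(π / 2), (f θ + f (2 * π - θ) + (f (π - θ) + f (π + θ))) := by
  have hi : ∀ (g : ℝ → ℂ), Continuous g → ∀ a b : ℝ, IntervalIntegrable g volume a b :=
    fun g hg a b => hg.intervalIntegrable a b
  rw [intervalIntegral.integral_add (hi _ (by fun_prop) _ _) (hi _ (by fun_prop) _ _),
    intervalIntegral.integral_add (hi _ (by fun_prop) _ _) (hi _ (by fun_prop) _ _),
    intervalIntegral.integral_add (hi _ (by fun_prop) _ _) (hi _ (by fun_prop) _ _),
    intervalIntegral.integral_comp_sub_left, intervalIntegral.integral_comp_sub_left,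
    intervalIntegral.integral_comp_add_left, sub_zero, sub_zero, add_zero,
    ← intervalIntegral.integral_add_adjacent_intervals (hi f hf 0 (π / 2)) (hi f hf _ (2 * π)),
    ← intervalIntegral.integral_add_adjacent_intervals (hi f hf (π / 2) π) (hi f hf _ (2 * π)),
    ← intervalIntegral.integral_add_adjacent_intervals (hi f hf π (π + π / 2)) (hi f hf _ (2 * π)),
    show π - π / 2 = π / 2 by ring, show 2 * π - π / 2 = π + π / 2 by ring]
  ring

lemma angular_integral_eq (a : ℂ) (r : ℝ) :
    ∫ θ in (0:ℝ)..(2 * π), Complex.exp (Complex.I * a * θ) *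
        Complex.exp (2 * Complex.I * r * (Real.cos θ : ℂ)) =
      (∫ θ in (0:ℝ)..(π / 2), (Complex.exp (Complex.I * a * θ) +
          Complex.exp (2 * π * Complex.I * a) * Complex.exp (Complex.I * (-a) * θ)) *
          Complex.exp (Complex.I * ((2 * Real.cos θ : ℝ) * r))) +
      ∫ θ in (0:ℝ)..(π / 2), (Complex.exp (π * Complex.I * a) *
          (Complex.exp (Complex.I * (-a) * θ) + Complex.exp (Complex.I * a * θ))) *
          Complex.exp (-Complex.I * ((2 * Real.cos θ : ℝ) * r)) := by
  rw [integral_zero_two_pi_eq_quarters (by fun_prop), ← intervalIntegral.integral_add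
    (Continuous.intervalIntegrable (by fun_prop) _ _)
    (Continuous.intervalIntegrable (by fun_prop) _ _)]
  refine intervalIntegral.integral_congr fun θ _ => ?_
  simp only [Real.cos_two_pi_sub, Real.cos_pi_sub, add_comm π θ, Real.cos_add_pi, add_mul, mul_add,
    ← Complex.exp_add]
  push_cast
  ring_nf

lemma continuous_intervalIntegral_mul_exp {p : ℝ → ℂ} (hp : Continuous p) (e : ℂ) :
    Continuous fun r : ℝ => ∫ θ in (0:ℝ)..(π / 2), p θ *
      Complex.exp (e * ((2 * Real.cos θ : ℝ) * r)) :=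
  intervalIntegral.continuous_parametric_intervalIntegral_of_continuous' (by fun_prop) _ _

lemma tendsto_integral_polar {s a K K' : ℂ} (hs : 0 < s.re) (hs1 : s.re < 1)
    (hK : Tendsto (oscPrimitive Complex.I s) atTop (𝓝 K))
    (hK' : Tendsto (oscPrimitive (-Complex.I) s) atTop (𝓝 K')) :
    Tendsto
      (fun R : ℝ => ∫ r in (0:ℝ)..R, ∫ θ in (0:ℝ)..(2 * π),
        (r : ℂ) ^ (s - 1) * Complex.exp (Complex.I * a * (θ : ℂ)) *
          Complex.exp (2 * Complex.I * (r : ℂ) * (Real.cos θ : ℂ)))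
      atTop (𝓝
        (K * ((∫ θ in (0:ℝ)..(π / 2), Complex.exp (Complex.I * a * θ) *
              ((2 * Real.cos θ : ℝ) : ℂ) ^ (-s)) +
            Complex.exp (2 * π * Complex.I * a) *
              ∫ θ in (0:ℝ)..(π / 2), Complex.exp (Complex.I * (-a) * θ) *
                ((2 * Real.cos θ : ℝ) : ℂ) ^ (-s)) +
          K' * (Complex.exp (π * Complex.I * a) *
            ((∫ θ in (0:ℝ)..(π / 2), Complex.exp (Complex.I * (-a) * θ) *
                ((2 * Real.cos θ : ℝ) : ℂ) ^ (-s)) +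
              ∫ θ in (0:ℝ)..(π / 2), Complex.exp (Complex.I * a * θ) *
                ((2 * Real.cos θ : ℝ) : ℂ) ^ (-s))))) := by
  have hint : ∀ {p : ℝ → ℂ}, Continuous p → IntervalIntegrable
      (fun θ : ℝ => p θ * ((2 * Real.cos θ : ℝ) : ℂ) ^ (-s)) volume 0 (π / 2) := fun hp =>
    (intervalIntegrable_iff_integrableOn_Ioo_of_le (by positivity)).2
      (integrableOn_mul_two_cos_cpow hs hs1 hp)
  have hpos := tendsto_integral_quarter_circle hs hs1 Complex.I_re hK
    (p := fun θ => Complex.exp (Complex.I * a * θ) +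
      Complex.exp (2 * π * Complex.I * a) * Complex.exp (Complex.I * (-a) * θ)) (by fun_prop)
  have hneg := tendsto_integral_quarter_circle hs hs1 (by simp) hK'
    (p := fun θ => Complex.exp (π * Complex.I * a) *
      (Complex.exp (Complex.I * (-a) * θ) + Complex.exp (Complex.I * a * θ))) (by fun_prop)
  have hcont : ∀ {q : ℝ → ℂ} {R : ℝ}, Continuous q →
      IntervalIntegrable (fun r : ℝ => (r : ℂ) ^ (s - 1) * q r) volume 0 R := fun hq =>
    (intervalIntegral.intervalIntegrable_cpow' (by simpa using hs)).mul_continuousOn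
      hq.continuousOn
  convert hpos.add hneg using 2
  · rw [← intervalIntegral.integral_add
      (hcont (continuous_intervalIntegral_mul_exp (by fun_prop) _))
      (hcont (continuous_intervalIntegral_mul_exp (by fun_prop) _))]
    refine intervalIntegral.integral_congr fun r _ => ?_
    simp only [mul_assoc ((r : ℂ) ^ (s - 1)), intervalIntegral.integral_const_mul,
      angular_integral_eq, mul_add]
  · congr 2
    · rw [← intervalIntegral.integral_const_mul, ← intervalIntegral.integral_add
        (hint (by fun_prop)) ((hint (by fun_prop)).const_mul _)]
      simp only [add_mul, mul_assoc]
    · rw [← intervalIntegral.integral_add (hint (by fun_prop)) (hint (by fun_prop)),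
        ← intervalIntegral.integral_const_mul]
      simp only [add_mul, mul_assoc]

lemma exp_identity_beta {γ δ : ℂ} (hγ : 0 < γ.re) (hδ : 0 < δ.re) (hs1 : (γ + δ).re < 1) :
    (Complex.exp (δ * (π * Complex.I)) ^ 2 + Complex.exp (γ * (π * Complex.I)) ^ 2) *
        Complex.betaIntegral γ δ =
      (Complex.exp (δ * (π * Complex.I)) ^ 2 + 1) * Complex.exp (γ * (π * Complex.I)) *
          Complex.betaIntegral γ (1 - (γ + δ)) +
        (Complex.exp (γ * (π * Complex.I)) ^ 2 + 1) * Complex.exp (δ * (π * Complex.I)) *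
          Complex.betaIntegral δ (1 - (γ + δ)) := by
  have h0 := pi_mul_betaIntegral hγ hδ hs1
  have h1 := betaIntegral_one_sub_add hγ hδ hs1
  have h2 := betaIntegral_one_sub_add hδ hγ (by rwa [add_comm])
  rw [add_comm δ γ] at h2
  have hsin : ∀ z : ℂ, Complex.sin (π * z) =
      ((Complex.exp (z * (π * Complex.I)))⁻¹ - Complex.exp (z * (π * Complex.I))) *
        Complex.I / 2 := by
    intro z
    rw [Complex.sin, ← Complex.exp_neg]
    ring_nf
  rw [hsin] at h0 h1 h2
  rw [add_mul, Complex.exp_add] at h0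
  set g := Complex.exp (γ * (π * Complex.I)) with hg
  set h := Complex.exp (δ * (π * Complex.I)) with hh
  have hg0 : g ≠ 0 := Complex.exp_ne_zero _
  have hh0 : h ≠ 0 := Complex.exp_ne_zero _
  refine mul_left_cancel₀ (Complex.ofReal_ne_zero.2 pi_ne_zero) ?_
  trans (h ^ 2 + g ^ 2) * (π * Complex.betaIntegral γ δ)
  · ring
  trans (h ^ 2 + 1) * g * (π * Complex.betaIntegral γ (1 - (γ + δ))) +
    (g ^ 2 + 1) * h * (π * Complex.betaIntegral δ (1 - (γ + δ)))
  · rw [h0, h1, h2]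
    field_simp
    ring
  · ring

/-- For 0 < Re γ < 1/2, 0 < Re γ̃ < 1/2, 0 < Re(γ+γ̃) < 1/2, the improper polar
integral Î, the inner oscillatory tails g(v) = lim_{T→∞} ∫_v^T u^{γ−1}e^{iu} du and
J = lim_{T→∞} ∫₀^T v^{γ̃−1}e^{iv} g(v) dv all exist, and
Î = (i/2)(1−e^{2πiγ})e^{−2πiγ̃}e^{iπ(γ+γ̃)/2}Γ(γ)Γ(γ̃) + (i/2)(e^{2πi(γ−γ̃)}−1)·J. -/
theorem stmt_5 (γ γt : ℂ)
    (hγ₁ : 0 < γ.re) (hγ₂ : γ.re < 1 / 2)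
    (hγt₁ : 0 < γt.re) (hγt₂ : γt.re < 1 / 2)
    (hs₁ : 0 < (γ + γt).re) (hs₂ : (γ + γt).re < 1 / 2) :
    ∃ (Ih : ℂ) (g : ℝ → ℂ) (J : ℂ),
      Tendsto
        (fun R : ℝ => ∫ r in (0:ℝ)..R, ∫ θ in (0:ℝ)..(2 * π),
          (r : ℂ) ^ (γ + γt - 1) *
            Complex.exp (Complex.I * (γ - γt) * (θ : ℂ)) *
            Complex.exp (2 * Complex.I * (r : ℂ) * (Real.cos θ : ℂ)))
        atTop (𝓝 Ih) ∧
      (∀ v : ℝ, 0 < v →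
        Tendsto
          (fun T : ℝ => ∫ u in v..T, (u : ℂ) ^ (γ - 1) * Complex.exp (Complex.I * (u : ℂ)))
          atTop (𝓝 (g v))) ∧
      Tendsto
        (fun T : ℝ => ∫ v in (0:ℝ)..T,
          (v : ℂ) ^ (γt - 1) * Complex.exp (Complex.I * (v : ℂ)) * g v)
        atTop (𝓝 J) ∧
      Ih = (Complex.I / 2) * (1 - Complex.exp (2 * π * Complex.I * γ)) *
              Complex.exp (-(2 * π * Complex.I * γt)) *
              Complex.exp (Complex.I * π * (γ + γt) / 2) *
              Complex.Gamma γ * Complex.Gamma γt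
            + (Complex.I / 2) * (Complex.exp (2 * π * Complex.I * (γ - γt)) - 1) * J := by
  have hs1 : (γ + γt).re < 1 := by linarith
  have hKγ : Tendsto (oscPrimitive Complex.I γ) atTop _ :=
    tendsto_integral_cpow_mul_exp_I hγ₁ (by linarith)
  have hKpos : Tendsto (oscPrimitive Complex.I (γ + γt)) atTop _ :=
    tendsto_integral_cpow_mul_exp_I hs₁ hs1
  have hKneg : Tendsto (oscPrimitive (-Complex.I) (γ + γt)) atTop
      (𝓝 (Complex.exp (-(Complex.I * π * (γ + γt) / 2)) * Complex.Gamma (γ + γt))) := by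
    unfold oscPrimitive
    simpa only [neg_mul] using tendsto_integral_cpow_mul_exp_neg_I hs₁ hs1
  refine ⟨_, _, _, tendsto_integral_polar hs₁ hs1 hKpos hKneg,
    fun v _ => tendsto_integral_tail hγ₁ hKγ v,
    tendsto_integral_mul_oscillatory_tail hγ₁ hγt₁ hKγ hKpos, ?_⟩
  rw [integral_Ioi_one_cpow_mul_one_add_cpow]
  have hA := integral_two_cos_cpow hγ₁ hs₁ hs1
  have hA' := integral_two_cos_cpow hγt₁ hs₁ hs1
  rw [show 2 * γ - (γ + γt) = γ - γt by ring] at hA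
  rw [show 2 * γt - (γ + γt) = -(γ - γt) by ring] at hA'
  have hB := betaIntegral_eq_add hγ₁ hγt₁
  have hΓ := Complex.Gamma_mul_Gamma_eq_betaIntegral hγ₁ hγt₁
  have hkey := exp_identity_beta hγ₁ hγt₁ hs1
  set E := Complex.exp (Complex.I * π * (γ + γt) / 2) with hE
  set g := Complex.exp (γ * (π * Complex.I)) with hg
  set h := Complex.exp (γt * (π * Complex.I)) with hh
  have hh0 : h ≠ 0 := Complex.exp_ne_zero _
  have hE0 : E ≠ 0 := Complex.exp_ne_zero _
  have hEE : E ^ 2 = g * h := by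
    rw [hE, hg, hh, ← Complex.exp_nat_mul, ← Complex.exp_add]
    push_cast
    ring_nf
  have e1 : Complex.exp (2 * π * Complex.I * γ) = g ^ 2 := by
    rw [hg, ← Complex.exp_nat_mul]; push_cast; ring_nf
  have e2 : Complex.exp (-(2 * π * Complex.I * γt)) = (h ^ 2)⁻¹ := by
    rw [hh, ← Complex.exp_nat_mul, ← Complex.exp_neg]; push_cast; ring_nf
  have e3 : Complex.exp (2 * π * Complex.I * (γ - γt)) = g ^ 2 * (h ^ 2)⁻¹ := by
    rw [← e1, ← e2, ← Complex.exp_add]; ring_nf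
  have e4 : Complex.exp (-(Complex.I * π * (γ + γt) / 2)) *
      Complex.exp (π * Complex.I * (γ - γt)) = E * (h ^ 2)⁻¹ := by
    rw [hE, ← e2, ← Complex.exp_add, ← Complex.exp_add]; ring_nf
  rw [e1, e2, e3]
  rw [hB] at hkey hΓ
  generalize Complex.betaIntegral γ (1 - (γ + γt)) = β₁ at *
  generalize Complex.betaIntegral γt (1 - (γ + γt)) = β₂ at *
  generalize (∫ θ in (0:ℝ)..(π / 2), Complex.exp (Complex.I * (γ - γt) * θ) *
    ((2 * Real.cos θ : ℝ) : ℂ) ^ (-(γ + γt))) = A at *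
  generalize (∫ θ in (0:ℝ)..(π / 2), Complex.exp (Complex.I * (-(γ - γt)) * θ) *
    ((2 * Real.cos θ : ℝ) : ℂ) ^ (-(γ + γt))) = A' at *
  generalize (∫ w in (0:ℝ)..1, (w : ℂ) ^ (γ - 1) * (1 + w : ℂ) ^ (-(γ + γt))) = B₀ at *
  generalize (∫ w in (0:ℝ)..1, (w : ℂ) ^ (γt - 1) * (1 + w : ℂ) ^ (-(γ + γt))) = B₁ at *
  generalize Complex.Gamma (γ + γt) = G at *
  have hkey' : A * (h ^ 2 + 1) + A' * (g ^ 2 + 1) =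
      Complex.I / 2 * ((1 - g ^ 2) * (B₀ + B₁) + (g ^ 2 - h ^ 2) * B₁) := by
    linear_combination (-Complex.I / 2) * ((h ^ 2 + 1) * hA + (g ^ 2 + 1) * hA' - hkey) +
      (A * (h ^ 2 + 1) + A' * (g ^ 2 + 1)) * Complex.I_sq
  trans E * G * (h ^ 2)⁻¹ * (A * (h ^ 2 + 1) + A' * (g ^ 2 + 1))
  · linear_combination G * (A' + A) * e4 - E * G * A * mul_inv_cancel₀ (pow_ne_zero 2 hh0)
  · rw [hkey']
    linear_combination -(Complex.I / 2 * (1 - g ^ 2) * (h ^ 2)⁻¹ * E) * hΓ -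
      (Complex.I / 2) * E * G * B₁ * mul_inv_cancel₀ (pow_ne_zero 2 hh0)
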